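/- arXiv:1903.02381 — 7 statements merged into one kernel-verified Lean document; each statement's English description precedes it below -/
import Mathlib

section
/- 2cos(π/30) = (1/2)·√(7 + √5 + √(30 + 6√5)). -/
open Real

theorem cos_two_pi_div_five : cos (2 * π / 5) = (√5 - 1) / 4 := by
  have h5 : √5 ^ 2 = 5 := sq_sqrt (by norm_num)
  rw [mul_div_assoc, cos_two_mul, cos_pi_div_five]
  linear_combination h5 / 8

theorem sq_sin_two_pi_div_five : sin (2 * π / 5) ^ 2 = (5 + √5) / 8 := by
  have h5 : √5 ^ 2 = 5 := sq_sqrt (by norm_num)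
  rw [sin_sq, cos_two_pi_div_five]
  linear_combination -h5 / 16

theorem cos_pi_div_fifteen : cos (π / 15) = (√5 - 1 + √(30 + 6 * √5)) / 8 := by
  have h3 : √3 ^ 2 = 3 := sq_sqrt (by norm_num)
  have hsin : 0 ≤ sin (2 * π / 5) :=
    sin_nonneg_of_nonneg_of_le_pi (by positivity) (by linarith [pi_pos])
  have hsqrt : √(30 + 6 * √5) = 4 * √3 * sin (2 * π / 5) := by
    rw [sqrt_eq_iff_mul_self_eq (by positivity) (by positivity)]
    linear_combination -16 * sin (2 * π / 5) ^ 2 * h3 - 48 * sq_sin_two_pi_div_five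
  rw [show π / 15 = 2 * π / 5 - π / 3 by ring, cos_sub, cos_pi_div_three, sin_pi_div_three,
    cos_two_pi_div_five, hsqrt]
  ring

/-- `2cos(π/30) = (1/2)·√(7 + √5 + √(30 + 6√5))`. -/
theorem two_cos_pi_div_thirty :
    2 * Real.cos (π / 30) =
      (1 / 2) * Real.sqrt (7 + Real.sqrt 5 + Real.sqrt (30 + 6 * Real.sqrt 5)) := by
  have hcos : 0 ≤ cos (π / 30) :=
    cos_nonneg_of_neg_pi_div_two_le_of_le (by linarith [pi_pos]) (by linarith [pi_pos])
  have hdouble : cos (π / 15) = 2 * cos (π / 30) ^ 2 - 1 := by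
    rw [← cos_two_mul]
    ring_nf
  have hsqrt : √(7 + √5 + √(30 + 6 * √5)) = 4 * cos (π / 30) := by
    rw [sqrt_eq_iff_mul_self_eq (by positivity) (by positivity)]
    linear_combination 8 * hdouble - 8 * cos_pi_div_fifteen
  rw [hsqrt]
  ring
end

section
/- 2cos(13π/30) = (1/2)·√(7 − √5 − √(30 − 6√5)). -/
open Real

lemma sqrt_three_mul_sin_pi_div_five :
    √3 * Real.sin (π / 5) = √(30 - 6 * √5) / 4 := by
  have hsin : 0 ≤ Real.sin (π / 5) :=
    (Real.sin_pos_of_pos_of_lt_pi (by positivity) (by linarith [Real.pi_pos])).le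
  have h3 : √3 ^ 2 = 3 := Real.sq_sqrt (by norm_num)
  have h5 : √5 ^ 2 = 5 := Real.sq_sqrt (by norm_num)
  have hsq : 30 - 6 * √5 = (4 * (√3 * Real.sin (π / 5))) ^ 2 := by
    rw [mul_pow, mul_pow, h3, Real.sin_sq, Real.cos_pi_div_five]
    linear_combination 3 * h5
  rw [hsq, Real.sqrt_sq (by positivity)]
  ring

lemma cos_thirteen_pi_div_fifteen :
    Real.cos (13 * π / 15) = -(1 + √5 + √(30 - 6 * √5)) / 8 := by
  have h : 13 * π / 15 = π - (π / 3 - π / 5) := by ring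
  rw [h, Real.cos_pi_sub, Real.cos_sub, Real.cos_pi_div_three, Real.sin_pi_div_three,
    Real.cos_pi_div_five]
  linear_combination (-1 / 2) * sqrt_three_mul_sin_pi_div_five

/-- `2cos(13π/30) = (1/2)·√(7 − √5 − √(30 − 6√5))`. -/
theorem two_cos_thirteen_pi_div_thirty :
    2 * Real.cos (13 * π / 30) =
      (1 / 2) * Real.sqrt (7 - Real.sqrt 5 - Real.sqrt (30 - 6 * Real.sqrt 5)) := by
  have hcos : 0 ≤ Real.cos (13 * π / 30) :=
    Real.cos_nonneg_of_neg_pi_div_two_le_of_le (by linarith [Real.pi_pos])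
      (by linarith [Real.pi_pos])
  have hsq : 7 - √5 - √(30 - 6 * √5) = (4 * Real.cos (13 * π / 30)) ^ 2 := by
    have h : 2 * (13 * π / 30) = 13 * π / 15 := by ring
    rw [mul_pow, Real.cos_sq, h, cos_thirteen_pi_div_fifteen]
    ring
  rw [hsq, Real.sqrt_sq (by positivity)]
  ring
end

section
/- Every component of the vector u = (2sinθ, 2sin2θ, 2sin3θ, 2sin4θ, 2sin5θ, sin2θ/sin3θ, sinθ/sin3θ, sinθ/sin2θ), with θ = π/30, is strictly positive, and 2cos(π/30) is the largest eigenvalue of the adjacency matrix A of the E8 Dynkin diagram: every real eigenvalue λ of A satisfies λ ≤ 2cos(π/30). -/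
open Real

/-- The adjacency matrix of the E8 Dynkin diagram. -/
def E8adj : Matrix (Fin 8) (Fin 8) ℝ :=
  !![0,1,0,0,0,0,0,0;
     1,0,1,0,0,0,0,0;
     0,1,0,1,0,0,0,0;
     0,0,1,0,1,0,0,0;
     0,0,0,1,0,1,0,1;
     0,0,0,0,1,0,1,0;
     0,0,0,0,0,1,0,0;
     0,0,0,0,1,0,0,0]

/-- The Perron–Frobenius vector of the adjacency matrix of the E8 Dynkin
diagram, with `θ = π/30`. -/
noncomputable def E8u : Fin 8 → ℝ :=
  ![2 * Real.sin (π / 30), 2 * Real.sin (2 * (π / 30)), 2 * Real.sin (3 * (π / 30)),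
    2 * Real.sin (4 * (π / 30)), 2 * Real.sin (5 * (π / 30)),
    Real.sin (2 * (π / 30)) / Real.sin (3 * (π / 30)),
    Real.sin (π / 30) / Real.sin (3 * (π / 30)),
    Real.sin (π / 30) / Real.sin (2 * (π / 30))]


/-- A nonnegative matrix with a positive vector `u` satisfying `A u ≤ c u` has no real eigenvalue
larger than `c`. -/
theorem eigenvalue_le_of_mulVec_le {n : Type*} [Fintype n] {A : Matrix n n ℝ} {u : n → ℝ} {c : ℝ}
    (hA : ∀ i j, 0 ≤ A i j) (hu : ∀ i, 0 < u i) (hAu : ∀ i, A.mulVec u i ≤ c * u i)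
    {lam : ℝ} {v : n → ℝ} (hv : v ≠ 0) (hAv : A.mulVec v = lam • v) : lam ≤ c := by
  obtain ⟨k, hk⟩ := Function.ne_iff.mp hv
  obtain ⟨i, -, hi⟩ := Finset.exists_max_image Finset.univ (fun j => |v j| / u j)
    ⟨k, Finset.mem_univ k⟩
  set m := |v i| / u i with hm
  have hle : ∀ j, |v j| ≤ m * u j := fun j => (div_le_iff₀ (hu j)).mp (hi j (Finset.mem_univ j))
  have hm_pos : 0 < m := (div_pos (abs_pos.mpr hk) (hu k)).trans_le (hi k (Finset.mem_univ k))
  have hvi : |v i| = m * u i := (div_mul_cancel₀ _ (hu i).ne').symm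
  have hvi_pos : 0 < |v i| := hvi ▸ mul_pos hm_pos (hu i)
  refine le_of_mul_le_mul_right ?_ hvi_pos
  calc lam * |v i| ≤ |lam| * |v i| := by gcongr; exact le_abs_self lam
    _ = |∑ j, A i j * v j| := by
        rw [← abs_mul]
        exact congrArg abs (congrFun hAv i).symm
    _ ≤ ∑ j, |A i j * v j| := Finset.abs_sum_le_sum_abs _ _
    _ ≤ ∑ j, m * (A i j * u j) := by
        refine Finset.sum_le_sum fun j _ => ?_
        rw [abs_mul, abs_of_nonneg (hA i j)]
        calc A i j * |v j| ≤ A i j * (m * u j) := mul_le_mul_of_nonneg_left (hle j) (hA i j)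
          _ = m * (A i j * u j) := by ring
    _ = m * A.mulVec u i := (Finset.mul_sum _ _ _).symm
    _ ≤ m * (c * u i) := mul_le_mul_of_nonneg_left (hAu i) hm_pos.le
    _ = c * |v i| := by rw [hvi]; ring

theorem sin_four_mul_eq (x : ℝ) : sin (4 * x) = sin x * (8 * cos x ^ 3 - 4 * cos x) := by
  rw [show 4 * x = 2 * (2 * x) by ring, sin_two_mul, sin_two_mul, cos_two_mul]
  ring

theorem sin_three_mul_eq (x : ℝ) : sin (3 * x) = sin x * (4 * cos x ^ 2 - 1) := by
  rw [sin_three_mul]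
  linear_combination (-4 * sin x) * sin_sq_add_cos_sq x

theorem sin_five_mul_eq (x : ℝ) :
    sin (5 * x) = sin x * (16 * cos x ^ 4 - 12 * cos x ^ 2 + 1) := by
  rw [show 5 * x = 4 * x + x by ring, sin_add, sin_four_mul_eq,
    show 4 * x = 2 * (2 * x) by ring, cos_two_mul, cos_two_mul]
  ring

theorem sin_mul_pi_div_thirty_pos {k : ℝ} (h₀ : 0 < k) (h₁ : k < 30) :
    0 < sin (k * (π / 30)) :=
  sin_pos_of_pos_of_lt_pi (by positivity) (by nlinarith [pi_pos])

theorem E8u_pos (i : Fin 8) : 0 < E8u i := by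
  have h₁ := sin_mul_pi_div_thirty_pos (k := 1) (by norm_num) (by norm_num)
  have h₂ := sin_mul_pi_div_thirty_pos (k := 2) (by norm_num) (by norm_num)
  have h₃ := sin_mul_pi_div_thirty_pos (k := 3) (by norm_num) (by norm_num)
  have h₄ := sin_mul_pi_div_thirty_pos (k := 4) (by norm_num) (by norm_num)
  have h₅ := sin_mul_pi_div_thirty_pos (k := 5) (by norm_num) (by norm_num)
  rw [one_mul] at h₁
  fin_cases i <;> simp only [E8u] <;> simp <;> positivity

theorem sin_five_mul_pi_div_thirty : sin (5 * (π / 30)) = 1 / 2 := by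
  rw [show 5 * (π / 30) = π / 6 by ring, sin_pi_div_six]

theorem three_lt_four_mul_cos_sq : 3 < 4 * cos (π / 30) ^ 2 := by
  have h : cos (π / 6) < cos (π / 30) :=
    cos_lt_cos_of_nonneg_of_le_pi (by positivity) (by linarith [pi_pos]) (by linarith [pi_pos])
  rw [cos_pi_div_six] at h
  nlinarith [Real.sq_sqrt (show (0 : ℝ) ≤ 3 by norm_num), Real.sqrt_nonneg 3]

/-- `2 cos (π / 30)` is a root of the characteristic polynomial of the E8 Dynkin diagram. -/
theorem two_mul_cos_pi_div_thirty_root :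
    (2 * cos (π / 30)) ^ 8 - 7 * (2 * cos (π / 30)) ^ 6 + 14 * (2 * cos (π / 30)) ^ 4
      - 8 * (2 * cos (π / 30)) ^ 2 + 1 = 0 := by
  have h := sin_five_mul_pi_div_thirty
  rw [sin_five_mul_eq] at h
  have hc := three_lt_four_mul_cos_sq
  have hsc := sin_sq_add_cos_sq (π / 30)
  set s := sin (π / 30)
  set c := cos (π / 30)
  have hsq : s ^ 2 * (16 * c ^ 4 - 12 * c ^ 2 + 1) ^ 2 = 1 / 4 := by
    rw [← mul_pow, h]; norm_num
  refine (mul_eq_zero.mp ?_).resolve_left (sub_pos.mpr hc).ne'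
  linear_combination (-4) * hsq + 4 * (16 * c ^ 4 - 12 * c ^ 2 + 1) ^ 2 * hsc

theorem E8adj_mulVec_E8u : E8adj.mulVec E8u = (2 * cos (π / 30)) • E8u := by
  have hs : 0 < sin (π / 30) := by
    simpa using sin_mul_pi_div_thirty_pos (k := 1) (by norm_num) (by norm_num)
  have hc : 0 < cos (π / 30) :=
    cos_pos_of_mem_Ioo ⟨by linarith [pi_pos], by linarith [pi_pos]⟩
  have hc₃ : 4 * cos (π / 30) ^ 2 - 1 ≠ 0 := by linarith [three_lt_four_mul_cos_sq]
  have h₅ := sin_five_mul_pi_div_thirty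
  have hroot := two_mul_cos_pi_div_thirty_root
  have hu : E8u = ![2 * sin (π / 30), 2 * sin (π / 30) * (2 * cos (π / 30)),
      2 * sin (π / 30) * (4 * cos (π / 30) ^ 2 - 1),
      2 * sin (π / 30) * (8 * cos (π / 30) ^ 3 - 4 * cos (π / 30)), 1,
      2 * cos (π / 30) / (4 * cos (π / 30) ^ 2 - 1), 1 / (4 * cos (π / 30) ^ 2 - 1),
      1 / (2 * cos (π / 30))] := by
    rw [E8u, h₅, sin_two_mul, sin_three_mul_eq, sin_four_mul_eq]
    ext i
    fin_cases i <;> simp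
    all_goals field_simp
  rw [sin_five_mul_eq] at h₅
  rw [hu]
  set s := sin (π / 30)
  set c := cos (π / 30)
  ext i
  fin_cases i <;> simp [E8adj, Matrix.mulVec, dotProduct, Fin.sum_univ_succ]
  · ring
  · ring
  · ring
  · linear_combination (-2) * h₅
  · obtain ⟨d, hd⟩ : ∃ d, d = 4 * c ^ 2 - 1 := ⟨_, rfl⟩
    rw [← hd] at hc₃ ⊢
    field_simp
    rw [hd]
    linear_combination 2 * (16 * c ^ 4 - 12 * c ^ 2 + 1) * h₅ - 2 * s * hroot
  · field_simp
    ring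
  · field_simp
  · field_simp

/-- Every component of `u` is strictly positive, and `2cos(π/30)` is the
largest eigenvalue of the adjacency matrix of the E8 Dynkin diagram. -/
theorem E8u_pos_and_top_eigenvalue :
    (∀ i, 0 < E8u i) ∧
      ∀ (lam : ℝ) (v : Fin 8 → ℝ), v ≠ 0 → E8adj.mulVec v = lam • v →
        lam ≤ 2 * Real.cos (π / 30) := by
  refine ⟨E8u_pos, fun lam v hv hAv => eigenvalue_le_of_mulVec_le ?_ E8u_pos ?_ hv hAv⟩
  · intro i j
    fin_cases i <;> fin_cases j <;> simp [E8adj]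
  · intro i
    rw [E8adj_mulVec_E8u, Pi.smul_apply, smul_eq_mul]
end

section
/- 2cos(π/15) = (1/2)·√(9 + √5 + 2√3·√((5 − √5)/2)). -/
open Real

theorem sin_pi_div_five_eq : Real.sin (π / 5) = Real.sqrt ((5 - Real.sqrt 5) / 2) / 2 := by
  have hs : 0 ≤ Real.sin (π / 5) :=
    sin_nonneg_of_nonneg_of_le_pi (by positivity) (by linarith [pi_pos])
  have h5 : Real.sqrt 5 ^ 2 = 5 := sq_sqrt (by norm_num)
  have hsq : (5 - Real.sqrt 5) / 2 = (2 * Real.sin (π / 5)) ^ 2 := by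
    rw [mul_pow, sin_sq, cos_pi_div_five]
    linarith
  rw [hsq, sqrt_sq (by positivity)]
  ring

theorem cos_two_pi_div_fifteen :
    Real.cos (2 * (π / 15)) =
      (1 + Real.sqrt 5 + 2 * Real.sqrt 3 * Real.sqrt ((5 - Real.sqrt 5) / 2)) / 8 := by
  rw [show 2 * (π / 15) = π / 3 - π / 5 by ring, cos_sub, cos_pi_div_three, sin_pi_div_three,
    cos_pi_div_five, sin_pi_div_five_eq]
  ring

/-- `2cos(π/15) = (1/2)·√(9 + √5 + 2√3·√((5 − √5)/2))`. -/
theorem two_cos_pi_div_fifteen :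
    2 * Real.cos (π / 15) =
      (1 / 2) * Real.sqrt (9 + Real.sqrt 5 +
        2 * Real.sqrt 3 * Real.sqrt ((5 - Real.sqrt 5) / 2)) := by
  have hc : 0 ≤ Real.cos (π / 15) :=
    cos_nonneg_of_neg_pi_div_two_le_of_le (by linarith [pi_pos]) (by linarith [pi_pos])
  have hsq : 9 + Real.sqrt 5 + 2 * Real.sqrt 3 * Real.sqrt ((5 - Real.sqrt 5) / 2) =
      (4 * Real.cos (π / 15)) ^ 2 := by
    linarith [cos_two_pi_div_fifteen, cos_two_mul (π / 15)]
  rw [hsq, sqrt_sq (by positivity)]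
  ring
end

section
/- Let α_1, …, α_8 ∈ ℝ^8 be vectors whose Gram matrix is the Cartan matrix C of E8 (i.e. (α_i, α_i) = 2 for all i and (α_i, α_j) = −1 when {i,j} is an edge of the E8 Dynkin diagram with edges {1,2},{2,3},{3,4},{4,5},{5,6},{6,7},{5,8}, and (α_i, α_j) = 0 otherwise). Let δ = 2α_1 + 3α_2 + 4α_3 + 5α_4 + 6α_5 + 4α_6 + 2α_7 + 3α_8, let α_0 = −δ, and let n_0 = 1, (n_1,…,n_8) = (2,3,4,5,6,4,2,3). Then the 8×8 matrix B with entries B_{ab} = Σ_{j=0}^{8} n_j (α_j)_a (α_j)_b has characteristic polynomial P(x) = x^8 − 60x^7 + 1440x^6 − 18000x^5 + 127440x^4 − 518400x^3 + 1166400x^2 − 1296000x + 518400. -/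
open Polynomial Matrix

/-- The Cartan matrix of E8 (simple roots α1–α7 form a chain and α8
is attached to α5). -/
def E8cartan : Matrix (Fin 8) (Fin 8) ℝ :=
  !![2,-1,0,0,0,0,0,0;
     -1,2,-1,0,0,0,0,0;
     0,-1,2,-1,0,0,0,0;
     0,0,-1,2,-1,0,0,0;
     0,0,0,-1,2,-1,0,-1;
     0,0,0,0,-1,2,-1,0;
     0,0,0,0,0,-1,2,0;
     0,0,0,0,-1,0,0,2]

/-- The marks of E8: coefficients of the highest root in the simple-root
basis. -/
def E8marks : Fin 8 → ℝ := ![2,3,4,5,6,4,2,3]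

/-- The product of `diag(n) + n nᵀ` with the Cartan matrix of E8, where `n` is the vector of marks;
the first column is special because `nᵀ C = (1, 0, …, 0)`. -/
def E8markedCartan : Matrix (Fin 8) (Fin 8) ℝ :=
  !![6,-2,0,0,0,0,0,0;
     0,6,-3,0,0,0,0,0;
     4,-4,8,-4,0,0,0,0;
     5,0,-5,10,-5,0,0,0;
     6,0,0,-6,12,-6,0,-6;
     4,0,0,0,-4,8,-4,0;
     2,0,0,0,0,-2,4,0;
     3,0,0,0,-3,0,0,6]

lemma marks_vecMul_cartan : E8marks ᵥ* E8cartan = ![1,0,0,0,0,0,0,0] := by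
  ext j
  fin_cases j <;> norm_num [vecMul, dotProduct, Fin.sum_univ_succ, E8marks, E8cartan]

lemma diagonal_add_vecMulVec_marks_mul_cartan :
    (diagonal E8marks + vecMulVec E8marks E8marks) * E8cartan = E8markedCartan := by
  rw [add_mul, vecMulVec_mul, marks_vecMul_cartan]
  ext i j
  rw [Matrix.add_apply, diagonal_mul, vecMulVec_apply]
  fin_cases i <;> fin_cases j <;> norm_num [E8marks, E8cartan, E8markedCartan]

set_option maxHeartbeats 4000000 in
lemma E8markedCartan_charpoly :
    E8markedCartan.charpoly = X ^ 8 - 60 * X ^ 7 + 1440 * X ^ 6 - 18000 * X ^ 5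
      + 127440 * X ^ 4 - 518400 * X ^ 3 + 1166400 * X ^ 2
      - 1296000 * X + 518400 := by
  refine Polynomial.funext fun x => ?_
  have hx : scalar (Fin 8) x - E8markedCartan =
      !![x-6,2,0,0,0,0,0,0;
         0,x-6,3,0,0,0,0,0;
         -4,4,x-8,4,0,0,0,0;
         -5,0,5,x-10,5,0,0,0;
         -6,0,0,6,x-12,6,0,6;
         -4,0,0,0,4,x-8,4,0;
         -2,0,0,0,0,2,x-4,0;
         -3,0,0,0,3,0,0,x-6] := by
    ext i j
    fin_cases i <;> fin_cases j <;> norm_num [E8markedCartan, scalar_apply, diagonal_apply]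
  rw [Matrix.eval_charpoly, hx]
  simp [Matrix.det_succ_row_zero, Fin.sum_univ_succ, Fin.succAbove]
  ring

/-- If `α_1, …, α_8 ∈ ℝ^8` have Gram matrix equal to the Cartan matrix of E8,
`δ = Σ n_j α_j` is the highest root, `α_0 = −δ` and `n_0 = 1`, then the
mass-squared matrix `B_{ab} = Σ_{j=0}^{8} n_j (α_j)_a (α_j)_b` of the E8
two-dimensional Toda lattice has characteristic polynomial
`x^8 − 60x^7 + 1440x^6 − 18000x^5 + 127440x^4 − 518400x^3 + 1166400x^2
− 1296000x + 518400`. -/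
theorem E8_massSquaredMatrix_charpoly (α : Fin 8 → Fin 8 → ℝ)
    (hGram : ∀ i j, α i ⬝ᵥ α j = E8cartan i j)
    (δ : Fin 8 → ℝ) (hδ : δ = ∑ j, E8marks j • α j)
    (B : Matrix (Fin 8) (Fin 8) ℝ)
    (hB : B = Matrix.of fun a b =>
      (-δ) a * (-δ) b + ∑ j, E8marks j * α j a * α j b) :
    B.charpoly = X ^ 8 - 60 * X ^ 7 + 1440 * X ^ 6 - 18000 * X ^ 5
      + 127440 * X ^ 4 - 518400 * X ^ 3 + 1166400 * X ^ 2
      - 1296000 * X + 518400 := by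
  have hB' : B = (of α)ᵀ * ((diagonal E8marks + vecMulVec E8marks E8marks) * of α) := by
    have hδ' : E8marks ᵥ* of α = δ := by
      rw [hδ, vecMul_eq_sum]
      rfl
    rw [add_mul, vecMulVec_mul, hδ', mul_add, mul_vecMulVec, mulVec_transpose, hδ', hB]
    ext a b
    simp only [of_apply, Matrix.add_apply, vecMulVec_apply,
      Matrix.mul_apply (M := (of α)ᵀ), diagonal_mul, transpose_apply, Pi.neg_apply, neg_mul_neg]
    rw [add_comm]
    congr 1
    exact Finset.sum_congr rfl fun j _ => by ring
  have hC : of α * (of α)ᵀ = E8cartan := by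
    ext i j
    exact hGram i j
  rw [hB', charpoly_mul_comm, mul_assoc, hC, diagonal_add_vecMulVec_marks_mul_cartan,
    E8markedCartan_charpoly]
end

section
/- Let θ = π/30, let u = (2sinθ, 2sin2θ, 2sin3θ, 2sin4θ, 2sin5θ, sin2θ/sin3θ, sinθ/sin3θ, sinθ/sin2θ), and let M = 2√3·sin(6θ)/sin(θ). Then M^4·(u_2·u_5·u_7·u_8)^2 = 720. -/
open Real

/-- The normalization constant `M = 2√3·sin(6θ)/sin(θ)` relating the masses to
`u` via `m_j² = M·u_j²`. -/
noncomputable def E8M : ℝ :=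
  2 * Real.sqrt 3 * Real.sin (6 * (π / 30)) / Real.sin (π / 30)

/-- `M⁴·(u₂·u₅·u₇·u₈)² = 720`. -/
theorem E8M_normalization :
    E8M ^ 4 * (E8u 1 * E8u 4 * E8u 6 * E8u 7) ^ 2 = 720 := by
  have hpos {x : ℝ} (h0 : 0 < x) (h1 : x < π) : sin x ≠ 0 := (sin_pos_of_pos_of_lt_pi h0 h1).ne'
  have hπ := pi_pos
  have h1 : sin (π / 30) ≠ 0 := hpos (by linarith) (by linarith)
  have h2 : sin (2 * (π / 30)) ≠ 0 := hpos (by linarith) (by linarith)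
  have h3 : sin (3 * (π / 30)) ≠ 0 := hpos (by linarith) (by linarith)
  have h5 : sin (5 * (π / 30)) = 1 / 2 := by
    rw [show 5 * (π / 30) = π / 6 by ring, sin_pi_div_six]
  have hcos : cos (6 * (π / 30)) = (1 + √5) / 4 := by
    rw [show 6 * (π / 30) = π / 5 by ring, cos_pi_div_five]
  have hsqrt5 : √5 ^ 2 = 5 := sq_sqrt (by norm_num)
  have hsqrt3 : √3 ^ 4 = 9 := by
    rw [show √3 ^ 4 = (√3 ^ 2) ^ 2 by ring, sq_sqrt (by norm_num)]
    norm_num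
  have h6sq : sin (6 * (π / 30)) ^ 2 = (5 - √5) / 8 := by
    rw [sin_sq, hcos]
    linear_combination -(1 / 16) * hsqrt5
  have h3sq : sin (3 * (π / 30)) ^ 2 = (3 - √5) / 8 := by
    rw [sin_sq_eq_half_sub, show 2 * (3 * (π / 30)) = 6 * (π / 30) by ring, hcos]
    ring
  have hkey : 4 * sin (6 * (π / 30)) ^ 4 = 5 * sin (3 * (π / 30)) ^ 2 := by
    rw [show sin (6 * (π / 30)) ^ 4 = (sin (6 * (π / 30)) ^ 2) ^ 2 by ring, h6sq, h3sq]
    linear_combination (1 / 16) * hsqrt5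
  have hred : E8M ^ 4 * (E8u 1 * E8u 4 * E8u 6 * E8u 7) ^ 2 =
      64 * √3 ^ 4 * sin (6 * (π / 30)) ^ 4 / sin (3 * (π / 30)) ^ 2 := by
    change (2 * √3 * sin (6 * (π / 30)) / sin (π / 30)) ^ 4 *
      (2 * sin (2 * (π / 30)) * (2 * sin (5 * (π / 30))) *
        (sin (π / 30) / sin (3 * (π / 30))) * (sin (π / 30) / sin (2 * (π / 30)))) ^ 2 = _
    rw [h5]
    generalize sin (π / 30) = a at *
    generalize sin (2 * (π / 30)) = b at *
    generalize sin (3 * (π / 30)) = c at *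
    field_simp
    ring
  rw [hred, hsqrt3, div_eq_iff (pow_ne_zero 2 h3)]
  linear_combination 144 * hkey
end

section
/- Solving the recurrence u_2 = λu_1, u_1 + u_3 = λu_2, u_2 + u_4 = λu_3, u_3 + u_5 = λu_4, u_4 + u_6 + u_8 = λu_5, u_5 + u_7 = λu_6, u_6 = λu_7, u_5 = λu_8 with λ = 2cos(π/30) and the normalization u_1 = 2sin(π/30): the unique solution is u = (2sinθ, 2sin2θ, 2sin3θ, 2sin4θ, 2sin5θ, sin2θ/sin3θ, sinθ/sin3θ, sinθ/sin2θ) with θ = π/30. That is, any vector v ∈ ℝ^8 satisfying these eight equations with λ = 2cos(π/30) and v_1 = 2sin(π/30) equals u. -/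
open Real

/-- The three-term recurrence of the sine along an arithmetic progression of step `y`. -/
theorem sin_add_eq_two_mul_cos_mul_sin_sub (x y : ℝ) :
    Real.sin (x + y) = 2 * Real.cos y * Real.sin x - Real.sin (x - y) := by
  rw [Real.sin_add, Real.sin_sub]
  ring

/-- Any vector `v ∈ ℝ^8` solving the eigenvalue recurrence of the E8 Dynkin
diagram with `λ = 2cos(π/30)`, normalized by `v₁ = 2sin(π/30)`, equals the
Perron–Frobenius vector `u`. -/
theorem E8u_unique_solution (v : Fin 8 → ℝ) (lam : ℝ)
    (hlam : lam = 2 * Real.cos (π / 30))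
    (h1 : v 1 = lam * v 0)
    (h2 : v 0 + v 2 = lam * v 1)
    (h3 : v 1 + v 3 = lam * v 2)
    (h4 : v 2 + v 4 = lam * v 3)
    (h5 : v 3 + v 5 + v 7 = lam * v 4)
    (h6 : v 4 + v 6 = lam * v 5)
    (h7 : v 5 = lam * v 6)
    (h8 : v 4 = lam * v 7)
    (hnorm : v 0 = 2 * Real.sin (π / 30)) :
    v = E8u := by
  have hpi := Real.pi_pos
  have s1 : 0 < Real.sin (π / 30) := Real.sin_pos_of_pos_of_lt_pi (by linarith) (by linarith)
  have s2 : 0 < Real.sin (2 * (π / 30)) :=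
    Real.sin_pos_of_pos_of_lt_pi (by linarith) (by linarith)
  have s3 : 0 < Real.sin (3 * (π / 30)) :=
    Real.sin_pos_of_pos_of_lt_pi (by linarith) (by linarith)
  have s5 : Real.sin (5 * (π / 30)) = 1 / 2 := by
    rw [← Real.sin_pi_div_six]
    ring_nf
  have e2 : Real.sin (2 * (π / 30)) = lam * Real.sin (π / 30) := by
    rw [hlam, Real.sin_two_mul]
    ring
  have e3 := sin_add_eq_two_mul_cos_mul_sin_sub (2 * (π / 30)) (π / 30)
  have e4 := sin_add_eq_two_mul_cos_mul_sin_sub (3 * (π / 30)) (π / 30)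
  have e5 := sin_add_eq_two_mul_cos_mul_sin_sub (4 * (π / 30)) (π / 30)
  rw [← hlam] at e3 e4 e5
  rw [show 2 * (π / 30) + π / 30 = 3 * (π / 30) by ring,
    show 2 * (π / 30) - π / 30 = π / 30 by ring] at e3
  rw [show 3 * (π / 30) + π / 30 = 4 * (π / 30) by ring,
    show 3 * (π / 30) - π / 30 = 2 * (π / 30) by ring] at e4
  rw [show 4 * (π / 30) + π / 30 = 5 * (π / 30) by ring,
    show 4 * (π / 30) - π / 30 = 3 * (π / 30) by ring] at e5
  have v1 : v 1 = 2 * Real.sin (2 * (π / 30)) := by rw [h1, hnorm, e2]; ring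
  have v2 : v 2 = 2 * Real.sin (3 * (π / 30)) := by
    linear_combination h2 - hnorm + lam * v1 - 2 * e3
  have v3 : v 3 = 2 * Real.sin (4 * (π / 30)) := by
    linear_combination h3 - v1 + lam * v2 - 2 * e4
  have v4 : v 4 = 2 * Real.sin (5 * (π / 30)) := by
    linear_combination h4 - v2 + lam * v3 - 2 * e5
  have v4_one : v 4 = 1 := by rw [v4, s5]; norm_num
  have v6 : v 6 = Real.sin (π / 30) / Real.sin (3 * (π / 30)) := by
    rw [eq_div_iff s3.ne']
    linear_combination v 6 * e3 + lam * v 6 * e2 - Real.sin (π / 30) * h6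
      - lam * Real.sin (π / 30) * h7 + Real.sin (π / 30) * v4_one
  have v5 : v 5 = Real.sin (2 * (π / 30)) / Real.sin (3 * (π / 30)) := by
    rw [h7, v6, e2, mul_div_assoc]
  have v7 : v 7 = Real.sin (π / 30) / Real.sin (2 * (π / 30)) := by
    rw [eq_div_iff s2.ne']
    linear_combination v 7 * e2 - Real.sin (π / 30) * h8 + Real.sin (π / 30) * v4_one
  funext i
  fin_cases i
  exacts [hnorm, v1, v2, v3, v4, v5, v6, v7]
end
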